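/- arXiv:2201.04849 — 4 statements merged into one kernel-verified Lean document; each statement's English description precedes it below -/
import Mathlib

section
/- Let (V, d) be a finite metric space with n = |V| ≥ 1, and let k, q be integers with k ≥ 1, 0 ≤ q < n. Set m = ⌈(n−q)/k⌉ and for each i ∈ V let NR_q(i) be the least r ≥ 0 such that |{j ∈ V : d(i,j) ≤ r}| ≥ m. Then for every S ⊆ V with |S| ≤ k, every O ⊆ V with |O| ≤ q, and every assignment σ : V∖O → S, there exists a vertex i ∈ V∖O with NR_q(i) ≤ 2·d(σ(i), i). -/
/-- division-free lower bound for any feasible IFkCO solution: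
there is a served vertex `i` with `NR_q i ≤ 2 * d (σ i) i`. -/
theorem stmt_0 {V : Type*} [MetricSpace V] [Fintype V]
    (n k q : ℕ) (hn : n = Fintype.card V) (hn1 : 1 ≤ n) (hk : 1 ≤ k) (hq : q < n)
    (m : ℕ) (hm : m = ⌈((n : ℚ) - (q : ℚ)) / (k : ℚ)⌉₊)
    (NRq : V → ℝ)
    (hNRq : ∀ i : V, IsLeast
      {r : ℝ | 0 ≤ r ∧ m ≤ (Finset.univ.filter fun j => dist i j ≤ r).card} (NRq i))
    (S O : Finset V) (hS : S.card ≤ k) (hO : O.card ≤ q)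
    (σ : V → V) (hσ : ∀ i ∉ O, σ i ∈ S) :
    ∃ i : V, i ∉ O ∧ NRq i ≤ 2 * dist (σ i) i := by
  classical
  have hk0 : (0 : ℚ) < k := by exact_mod_cast hk
  have hb : 0 < ((n : ℚ) - q) / k := div_pos (sub_pos.mpr (by exact_mod_cast hq)) hk0
  have hcard : (n : ℚ) - q ≤ (Oᶜ.card : ℚ) := by
    have h : n ≤ Oᶜ.card + q := by
      have := O.card_add_card_compl
      omega
    have h' : (n : ℚ) ≤ Oᶜ.card + q := by exact_mod_cast h
    linarith
  have hmaps : ∀ i ∈ Oᶜ, σ i ∈ S := fun i hi => hσ i (Finset.mem_compl.mp hi)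
  have hS0 : S.Nonempty := by
    have h : 0 < Oᶜ.card := by
      have := O.card_add_card_compl
      omega
    obtain ⟨i, hi⟩ := Finset.card_pos.mp h
    exact ⟨σ i, hmaps i hi⟩
  -- By pigeonhole, some center serves at least `m` vertices.
  obtain ⟨s, -, hs⟩ := Finset.exists_le_card_fiber_of_nsmul_le_card_of_maps_to hmaps hS0
    (b := ((n : ℚ) - q) / k) (by
      rw [nsmul_eq_mul]
      calc (S.card : ℚ) * (((n : ℚ) - q) / k) ≤ k * (((n : ℚ) - q) / k) := by gcongr
        _ = (n : ℚ) - q := by field_simp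
        _ ≤ _ := hcard)
  have hm_le : m ≤ (Oᶜ.filter fun i => σ i = s).card := hm ▸ Nat.ceil_le.mpr hs
  have hne : (Oᶜ.filter fun i => σ i = s).Nonempty :=
    Finset.card_pos.mp (by exact_mod_cast hb.trans_le hs)
  -- The farthest vertex served by `s` sees all the others within twice its distance to `s`.
  obtain ⟨i, hi, hmax⟩ := Finset.exists_max_image _ (fun j => dist s j) hne
  obtain ⟨hiO, his⟩ := Finset.mem_filter.mp hi
  refine ⟨i, Finset.mem_compl.mp hiO, (hNRq i).2 ⟨by positivity, hm_le.trans ?_⟩⟩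
  refine Finset.card_le_card fun j hj => ?_
  have h₁ := hmax j hj
  have h₂ := dist_triangle_left i j s
  simp only [Finset.mem_filter, Finset.mem_univ, true_and, his]
  linarith
end

section
/- Let (V, d) be a finite metric space with n = |V| ≥ 1, and let k, q be integers with k ≥ 1, 0 ≤ q < n. Set m = ⌈(n−q)/k⌉ and for each i ∈ V let NR_q(i) be the least r ≥ 0 such that |{j ∈ V : d(i,j) ≤ r}| ≥ m. Assume NR_q(i) > 0 for every i ∈ V. Then every feasible solution (S, O, σ) — i.e., S ⊆ V with |S| ≤ k, O ⊆ V with |O| ≤ q, σ : V∖O → S, and V∖O nonempty — has outlier-related fairness ratio at least 1/2: max over i ∈ V∖O of d(σ(i), i)/NR_q(i) ≥ 1/2. In particular the optimal value of the instance is at least 1/2. -/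
/-- every feasible IFkCO solution has outlier-related fairness
ratio at least `1/2`. -/
theorem stmt_1 {V : Type*} [MetricSpace V] [Fintype V] [DecidableEq V]
    (n k q : ℕ) (hn : n = Fintype.card V) (hn1 : 1 ≤ n) (hk : 1 ≤ k) (hq : q < n)
    (m : ℕ) (hm : m = ⌈((n : ℚ) - (q : ℚ)) / (k : ℚ)⌉₊)
    (NRq : V → ℝ)
    (hNRq : ∀ i : V, IsLeast
      {r : ℝ | 0 ≤ r ∧ m ≤ (Finset.univ.filter fun j => dist i j ≤ r).card} (NRq i))
    (hpos : ∀ i : V, 0 < NRq i)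
    (S O : Finset V) (hS : S.card ≤ k) (hO : O.card ≤ q)
    (σ : V → V) (hσ : ∀ i ∉ O, σ i ∈ S)
    (hne : (Finset.univ \ O).Nonempty) :
    (1 : ℝ) / 2 ≤ (Finset.univ \ O).sup' hne fun i => dist (σ i) i / NRq i := by
  have hk0 : (0 : ℚ) < k := by exact_mod_cast hk
  have hnq : (0 : ℚ) < (n : ℚ) - q := sub_pos.2 (by exact_mod_cast hq)
  have hmaps : ∀ i ∈ Finset.univ \ O, σ i ∈ S := fun i hi => hσ i (Finset.mem_sdiff.1 hi).2
  have hSne : S.Nonempty := let ⟨i, hi⟩ := hne; ⟨σ i, hmaps i hi⟩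
  have hcard : (n : ℚ) - q ≤ (Finset.univ \ O).card := by
    have h := Finset.card_sdiff_add_card_eq_card (Finset.subset_univ O)
    rw [Finset.card_univ, ← hn] at h
    have h' : (n : ℚ) ≤ (Finset.univ \ O).card + q := by exact_mod_cast (by omega)
    linarith
  have hmul : S.card • (((n : ℚ) - q) / k) ≤ (Finset.univ \ O).card := by
    refine le_trans ?_ hcard
    rw [nsmul_eq_mul]
    calc (S.card : ℚ) * (((n : ℚ) - q) / k) ≤ k * (((n : ℚ) - q) / k) := by gcongr
      _ = n - q := by field_simp
  obtain ⟨s, -, hs⟩ :=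
    Finset.exists_le_card_fiber_of_nsmul_le_card_of_maps_to hmaps hSne hmul
  set C := (Finset.univ \ O).filter fun i => σ i = s with hC
  have hmC : m ≤ C.card := hm ▸ Nat.ceil_le.2 hs
  have hCne : C.Nonempty := by
    rw [← Finset.card_pos]
    exact_mod_cast (div_pos hnq hk0).trans_le hs
  obtain ⟨i, hiC, hi⟩ := C.exists_max_image (fun j => dist s j) hCne
  obtain ⟨hiO, his⟩ := Finset.mem_filter.1 hiC
  have hNR : NRq i ≤ 2 * dist s i := by
    refine (hNRq i).2 ⟨by positivity, hmC.trans (Finset.card_le_card fun j hj => ?_)⟩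
    have h := dist_triangle_left i j s
    have := hi j hj
    simp only [Finset.mem_filter, Finset.mem_univ, true_and]
    linarith
  refine le_trans ?_ (Finset.le_sup' (fun i => dist (σ i) i / NRq i) hiO)
  simp only [his]
  rw [le_div_iff₀ (hpos i)]
  linarith
end

section
/- Let (V, d) be a finite metric space with n = |V| ≥ 1, and let k, q be integers with k ≥ 1, 0 ≤ q < n. Set m = ⌈(n−q)/k⌉ and for each i ∈ V let NR_q(i) be the least r ≥ 0 such that |{j ∈ V : d(i,j) ≤ r}| ≥ m. Let s′ ∈ V and let D ⊆ V be a nonempty set with |D| ≥ m, and let s_f ∈ D be a point of D at maximum distance from s′. Then every i ∈ D satisfies d(i, s_f) ≤ 2·d(s′, s_f), and consequently NR_q(s_f) ≤ 2·d(s′, s_f). -/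
/-- geometric core of the lower bound — for a cluster `D` with
`|D| ≥ m` and `s_f ∈ D` farthest from `s'`, every `i ∈ D` has
`d i s_f ≤ 2 * d s' s_f`, hence `NR_q s_f ≤ 2 * d s' s_f`. -/
theorem stmt_3 {V : Type*} [MetricSpace V] [Fintype V]
    (n k q : ℕ) (hn : n = Fintype.card V) (hn1 : 1 ≤ n) (hk : 1 ≤ k) (hq : q < n)
    (m : ℕ) (hm : m = ⌈((n : ℚ) - (q : ℚ)) / (k : ℚ)⌉₊)
    (NRq : V → ℝ)
    (hNRq : ∀ i : V, IsLeast
      {r : ℝ | 0 ≤ r ∧ m ≤ (Finset.univ.filter fun j => dist i j ≤ r).card} (NRq i))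
    (s' sf : V) (D : Finset V) (hDne : D.Nonempty) (hDm : m ≤ D.card)
    (hsf : sf ∈ D) (hmax : ∀ i ∈ D, dist s' i ≤ dist s' sf) :
    (∀ i ∈ D, dist i sf ≤ 2 * dist s' sf) ∧ NRq sf ≤ 2 * dist s' sf := by
  have key : ∀ i ∈ D, dist i sf ≤ 2 * dist s' sf := fun i hi => by
    linarith [dist_triangle_left i sf s', hmax i hi]
  refine ⟨key, (hNRq sf).2 ⟨by positivity, hDm.trans (Finset.card_le_card fun i hi => ?_)⟩⟩
  simpa [dist_comm sf i] using key i hi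
end

section
/- Let (V, d) be a finite metric space with n = |V| ≥ 1, and let k, q be integers with k ≥ 1, 0 ≤ q < n. Set m = ⌈(n−q)/k⌉ and for each i ∈ V let NR_q(i) be the least r ≥ 0 such that |{j ∈ V : d(i,j) ≤ r}| ≥ m; assume NR_q(i) > 0 for all i ∈ V. Let (S, O, σ) be a solution satisfying d(σ(i), i) ≤ 2·NR_q(i) for every i ∈ V∖O (with V∖O nonempty), and let (S*, O*, σ*) be any feasible solution, i.e., S* ⊆ V nonempty with |S*| ≤ k, O* ⊆ V with |O*| ≤ q, σ* : V∖O* → S*, and V∖O* nonempty. Then α(S, O, σ) ≤ 4·α(S*, O*, σ*), where α(S, O, σ) = max over i ∈ V∖O of d(σ(i), i)/NR_q(i). In particular, any solution satisfying the stated invariant is a 4-approximation for the individually fair k-center with outliers. -/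
/-- In a nonempty cluster of at least `m` points, the point farthest from the center `c` has
at least `m` points within twice its distance to `c`. -/
theorem exists_mem_card_le_card_filter_dist_le {V : Type*} [PseudoMetricSpace V] [Fintype V]
    (C : Finset V) (hC : C.Nonempty) (c : V) :
    ∃ i ∈ C, C.card ≤ (Finset.univ.filter fun j => dist i j ≤ 2 * dist c i).card := by
  obtain ⟨i, hi, hmax⟩ := C.exists_max_image (fun j => dist c j) hC
  refine ⟨i, hi, Finset.card_le_card fun j hj => ?_⟩
  simp only [Finset.mem_filter, Finset.mem_univ, true_and]
  have h₁ := dist_triangle_left i j c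
  have h₂ := hmax j hj
  linarith

/-- Some center serves at least the average number of non-outliers. -/
theorem exists_div_le_card_fiber {V : Type*} [Fintype V] [DecidableEq V]
    (k q : ℕ) (hk : 1 ≤ k) (hq : q < Fintype.card V) (S O : Finset V) (σ : V → V)
    (hSne : S.Nonempty) (hS : S.card ≤ k) (hO : O.card ≤ q) (hσ : ∀ i ∉ O, σ i ∈ S) :
    ∃ c ∈ S, ((Fintype.card V : ℚ) - q) / k ≤
      ((Finset.univ \ O).filter fun i => σ i = c).card := by
  have hkpos : (0 : ℚ) < k := by exact_mod_cast hk
  have hqn : (q : ℚ) < Fintype.card V := by exact_mod_cast hq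
  refine Finset.exists_le_card_fiber_of_nsmul_le_card_of_maps_to
    (fun i hi => hσ i (by simpa using hi)) hSne ?_
  have hcard : (Fintype.card V : ℚ) - q ≤ ((Finset.univ \ O).card : ℚ) := by
    have h := Finset.card_sdiff_add_card_eq_card (Finset.subset_univ O)
    rw [Finset.card_univ] at h
    have h' : Fintype.card V ≤ (Finset.univ \ O).card + q := by omega
    have h'' : (Fintype.card V : ℚ) ≤ ((Finset.univ \ O).card : ℚ) + q := by exact_mod_cast h'
    linarith
  calc S.card • (((Fintype.card V : ℚ) - q) / k)
      = S.card * (((Fintype.card V : ℚ) - q) / k) := nsmul_eq_mul _ _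
    _ ≤ k * (((Fintype.card V : ℚ) - q) / k) := by
        have : (S.card : ℚ) ≤ k := by exact_mod_cast hS
        have : 0 ≤ ((Fintype.card V : ℚ) - q) / k := div_nonneg (by linarith) hkpos.le
        gcongr
    _ = (Fintype.card V : ℚ) - q := by field_simp
    _ ≤ _ := hcard

/-- any solution satisfying the greedy invariant is a
4-approximation: `α(S, O, σ) ≤ 4 * α(S*, O*, σ*)` for every feasible
solution `(S*, O*, σ*)`. -/
theorem stmt_8 {V : Type*} [MetricSpace V] [Fintype V] [DecidableEq V]
    (n k q : ℕ) (hn : n = Fintype.card V) (hn1 : 1 ≤ n) (hk : 1 ≤ k) (hq : q < n)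
    (m : ℕ) (hm : m = ⌈((n : ℚ) - (q : ℚ)) / (k : ℚ)⌉₊)
    (NRq : V → ℝ)
    (hNRq : ∀ i : V, IsLeast
      {r : ℝ | 0 ≤ r ∧ m ≤ (Finset.univ.filter fun j => dist i j ≤ r).card} (NRq i))
    (hpos : ∀ i : V, 0 < NRq i)
    (S O : Finset V) (σ : V → V)
    (hσ : ∀ i ∉ O, σ i ∈ S)
    (hinv : ∀ i ∉ O, dist (σ i) i ≤ 2 * NRq i)
    (hne : (Finset.univ \ O).Nonempty)
    (Sstar Ostar : Finset V) (σstar : V → V)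
    (hSstarne : Sstar.Nonempty) (hSstar : Sstar.card ≤ k) (hOstar : Ostar.card ≤ q)
    (hσstar : ∀ i ∉ Ostar, σstar i ∈ Sstar)
    (hnestar : (Finset.univ \ Ostar).Nonempty) :
    ((Finset.univ \ O).sup' hne fun i => dist (σ i) i / NRq i) ≤
      4 * (Finset.univ \ Ostar).sup' hnestar fun i => dist (σstar i) i / NRq i := by
  obtain ⟨c, -, hc⟩ := exists_div_le_card_fiber k q hk (hn ▸ hq) Sstar Ostar σstar
    hSstarne hSstar hOstar hσstar
  rw [← hn] at hc
  have hCne : ((Finset.univ \ Ostar).filter fun i => σstar i = c).Nonempty := by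
    have hqn : (q : ℚ) < n := by exact_mod_cast hq
    have hkpos : (0 : ℚ) < k := by exact_mod_cast hk
    have h := (div_pos (sub_pos.2 hqn) hkpos).trans_le hc
    exact Finset.card_pos.1 (by exact_mod_cast h)
  obtain ⟨i, hi, hball⟩ := exists_mem_card_le_card_filter_dist_le _ hCne c
  obtain ⟨hiO, hic⟩ := Finset.mem_filter.1 hi
  have hNR : NRq i ≤ 2 * dist c i :=
    (hNRq i).2 ⟨by positivity, (hm.trans_le (Nat.ceil_le.2 hc)).trans hball⟩
  have hlower : 1 / 2 ≤ (Finset.univ \ Ostar).sup' hnestar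
      fun i => dist (σstar i) i / NRq i := by
    refine le_trans ?_ (Finset.le_sup' (fun i => dist (σstar i) i / NRq i) hiO)
    rw [hic, le_div_iff₀ (hpos i)]
    linarith
  have hupper : ((Finset.univ \ O).sup' hne fun i => dist (σ i) i / NRq i) ≤ 2 :=
    Finset.sup'_le _ _ fun j hj => (div_le_iff₀ (hpos j)).2 (hinv j (by simpa using hj))
  linarith
end
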